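/- Every preference relation in the lottery framework can be modeled by a preference relation in the act framework: for every lottery decision situation (L, C, P) and every binary relation ⪯_L on L, there exist a plausibilistic decision situation ((A,S,C), P, Pl) inducing (L, C, P) and a binary relation ⪯_A on A such that for all a_1, a_2 ∈ A, a_1 ⪯_A a_2 iff ℓ^{Pl}_{a_1} ⪯_L ℓ^{Pl}_{a_2}. -/

import Mathlib

open Classical

noncomputable section

universe u v x

/-- A plausibility domain: a partially ordered set `(P, le)` with bottom and top
elements. -/
structure PlausDomain (P : Type x) where
  le : P → P → Prop
  le_refl : ∀ p, le p p
  le_trans : ∀ p q r, le p q → le q r → le p r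
  le_antisymm : ∀ p q, le p q → le q p → p = q
  bot : P
  top : P
  bot_le : ∀ p, le bot p
  le_top : ∀ p, le p top

/-- `Pl : 2^S → P` is a plausibility measure: `Pl ∅ = ⊥`, `Pl S = ⊤`, and `Pl` is
monotone. -/
def IsPlausMeasureD {S : Type u} {P : Type x} (D : PlausDomain P) (Pl : Set S → P) :
    Prop :=
  Pl ∅ = D.bot ∧ Pl Set.univ = D.top ∧ ∀ X Y : Set S, X ⊆ Y → D.le (Pl X) (Pl Y)

/-- A simple act: a function from states to consequences with finite range. -/
def SimpleAct (S : Type u) (C : Type v) : Type (max u v) :=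
  {a : S → C // (Set.range a).Finite}

/-- A simple lottery over the consequences `C` with values in the plausibility domain
`D`: a plausibility measure `val` on the subsets of its finite nonempty support
(`val` is normalized by `val X = val (X ∩ supp)` so that it is determined by its values
on subsets of the support). -/
structure SimpleLottery (C : Type v) {P : Type x} (D : PlausDomain P) where
  supp : Set C
  supp_nonempty : supp.Nonempty
  supp_finite : supp.Finite
  val : Set C → P
  val_inter : ∀ X : Set C, val X = val (X ∩ supp)
  val_empty : val ∅ = D.bot
  val_supp : val supp = D.top
  val_mono : ∀ X Y : Set C, X ⊆ Y → Y ⊆ supp → D.le (val X) (val Y)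

/-- The lottery `ℓ^Pl_a` induced by a simple act `a` in a plausibilistic decision
situation: its support is `ran(a)` and `ℓ^Pl_a(Y) = Pl(a⁻¹(Y))` for `Y ⊆ ran(a)`. -/
def inducedLottery {S : Type u} {C : Type v} {P : Type x} (D : PlausDomain P)
    (Pl : Set S → P) (hPl : IsPlausMeasureD D Pl) (hS : Nonempty S)
    (a : SimpleAct S C) : SimpleLottery C D where
  supp := Set.range a.1
  supp_nonempty := by haveI := hS; exact Set.range_nonempty a.1
  supp_finite := a.2
  val := fun Y => Pl (a.1 ⁻¹' (Y ∩ Set.range a.1))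
  val_inter := fun X => by
    show Pl (a.1 ⁻¹' (X ∩ Set.range a.1)) =
      Pl (a.1 ⁻¹' (X ∩ Set.range a.1 ∩ Set.range a.1))
    rw [Set.inter_assoc, Set.inter_self]
  val_empty := by simpa using hPl.1
  val_supp := by
    show Pl (a.1 ⁻¹' (Set.range a.1 ∩ Set.range a.1)) = D.top
    rw [Set.inter_self]
    have h : a.1 ⁻¹' Set.range a.1 = Set.univ := by
      ext s; simp
    rw [h]; exact hPl.2.1
  val_mono := fun X Y hXY _ =>
    hPl.2.2 _ _ (Set.preimage_mono (Set.inter_subset_inter_left _ hXY))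

/-- The set of states used in the induction construction: functions choosing, for each
lottery in `L`, a consequence in its support. -/
def LStates {C : Type v} {P : Type x} {D : PlausDomain P}
    (L : Set (SimpleLottery C D)) : Type (max v x) :=
  {f : ↥L → C // ∀ ℓ : ↥L, f ℓ ∈ ℓ.1.supp}

section LotteryConstruction

variable {C : Type v} {P : Type x} {D : PlausDomain P} {L : Set (SimpleLottery C D)}

/-- The consequences `c` in the support of `ℓ` such that `X` contains every state choosing `c`
for `ℓ`. -/
def LStates.core (ℓ : ↥L) (X : Set (LStates L)) : Set C :=
  {c | c ∈ ℓ.1.supp ∧ ∀ s : LStates L, s.1 ℓ = c → s ∈ X}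

/-- The plausibility measure on `LStates L` whose value at `X` is read off from the cylinders
contained in `X`: it is `⊤` when cylinders over several lotteries occur. -/
def LStates.plaus (X : Set (LStates L)) : P :=
  if h : ∃! ℓ : ↥L, (LStates.core ℓ X).Nonempty then h.choose.1.val (LStates.core h.choose X)
  else if ∃ ℓ : ↥L, (LStates.core ℓ X).Nonempty then D.top else D.bot

namespace LStates

instance : Nonempty (LStates L) :=
  ⟨⟨fun ℓ => ℓ.1.supp_nonempty.some, fun ℓ => ℓ.1.supp_nonempty.some_mem⟩⟩

theorem exists_apply_eq (s : LStates L) (ℓ : ↥L) {c : C} (hc : c ∈ ℓ.1.supp) :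
    ∃ t : LStates L, t.1 ℓ = c ∧ ∀ ℓ', ℓ' ≠ ℓ → t.1 ℓ' = s.1 ℓ' := by
  refine ⟨⟨Function.update s.1 ℓ c, fun ℓ' => ?_⟩, by simp, fun ℓ' h => by simp [h]⟩
  by_cases h : ℓ' = ℓ
  · subst h; simpa using hc
  · simpa [h] using s.2 ℓ'

theorem range_apply (ℓ : ↥L) : Set.range (fun s : LStates L => s.1 ℓ) = ℓ.1.supp := by
  ext c
  constructor
  · rintro ⟨s, rfl⟩; exact s.2 ℓ
  · intro hc
    obtain ⟨t, ht, -⟩ := exists_apply_eq (Classical.arbitrary (LStates L)) ℓ hc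
    exact ⟨t, ht⟩

theorem core_mono (ℓ : ↥L) {X Y : Set (LStates L)} (h : X ⊆ Y) : core ℓ X ⊆ core ℓ Y :=
  fun _ hc => ⟨hc.1, fun s hs => h (hc.2 s hs)⟩

theorem core_subset_supp (ℓ : ↥L) (X : Set (LStates L)) : core ℓ X ⊆ ℓ.1.supp :=
  fun _ hc => hc.1

theorem core_univ (ℓ : ↥L) : core ℓ (Set.univ : Set (LStates L)) = ℓ.1.supp := by
  ext c; simp [core]

theorem core_empty (ℓ : ↥L) : core ℓ (∅ : Set (LStates L)) = ∅ := by
  refine Set.eq_empty_iff_forall_notMem.2 fun c hc => ?_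
  obtain ⟨t, ht, -⟩ := exists_apply_eq (Classical.arbitrary (LStates L)) ℓ hc.1
  exact hc.2 t ht

theorem core_preimage (ℓ : ↥L) {Y : Set C} (hY : Y ⊆ ℓ.1.supp) :
    core ℓ {s : LStates L | s.1 ℓ ∈ Y} = Y := by
  ext c
  constructor
  · rintro ⟨hc, h⟩
    obtain ⟨t, rfl, -⟩ := exists_apply_eq (Classical.arbitrary (LStates L)) ℓ hc
    exact h t rfl
  · exact fun hc => ⟨hY hc, fun s hs => by simpa [hs] using hc⟩

theorem core_preimage_of_ne {ℓ ℓ' : ↥L} (hne : ℓ' ≠ ℓ) {Y : Set C} {c₀ : C}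
    (hc₀ : c₀ ∈ ℓ.1.supp) (hY : c₀ ∉ Y) : core ℓ' {s : LStates L | s.1 ℓ ∈ Y} = ∅ := by
  refine Set.eq_empty_iff_forall_notMem.2 fun c hc => hY ?_
  obtain ⟨t, ht, -⟩ := exists_apply_eq (Classical.arbitrary (LStates L)) ℓ' hc.1
  obtain ⟨r, hr, hr'⟩ := exists_apply_eq t ℓ hc₀
  have h : r.1 ℓ ∈ Y := hc.2 r ((hr' ℓ' hne).trans ht)
  rwa [hr] at h

theorem plaus_of_unique {X : Set (LStates L)} {ℓ : ↥L} (h : (core ℓ X).Nonempty)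
    (huniq : ∀ ℓ', (core ℓ' X).Nonempty → ℓ' = ℓ) : plaus X = ℓ.1.val (core ℓ X) := by
  have hex : ∃! ℓ : ↥L, (core ℓ X).Nonempty := ⟨ℓ, h, huniq⟩
  have hc : hex.choose = ℓ := huniq _ hex.choose_spec.1
  rw [plaus, dif_pos hex, hc]

theorem plaus_of_forall_empty {X : Set (LStates L)} (h : ∀ ℓ, ¬ (core ℓ X).Nonempty) :
    plaus X = D.bot := by
  rw [plaus, dif_neg fun ⟨ℓ, hℓ, _⟩ => h ℓ hℓ, if_neg fun ⟨ℓ, hℓ⟩ => h ℓ hℓ]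

theorem plaus_of_ne {X : Set (LStates L)} {ℓ ℓ' : ↥L} (hne : ℓ' ≠ ℓ)
    (h : (core ℓ X).Nonempty) (h' : (core ℓ' X).Nonempty) : plaus X = D.top := by
  rw [plaus, dif_neg fun hu => hne (hu.unique h' h), if_pos ⟨ℓ, h⟩]

theorem plaus_empty : plaus (∅ : Set (LStates L)) = D.bot :=
  plaus_of_forall_empty fun ℓ => by simp [core_empty]

theorem plaus_univ (hL : L.Nonempty) : plaus (Set.univ : Set (LStates L)) = D.top := by
  obtain ⟨ℓ, hℓ⟩ := hL
  have hne : ∀ ℓ : ↥L, (core ℓ Set.univ).Nonempty := fun ℓ => by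
    rw [core_univ]; exact ℓ.1.supp_nonempty
  by_cases h : ∀ ℓ' : ↥L, ℓ' = ⟨ℓ, hℓ⟩
  · rw [plaus_of_unique (hne ⟨ℓ, hℓ⟩) fun ℓ' _ => h ℓ', core_univ]
    exact ℓ.val_supp
  · obtain ⟨ℓ', h'⟩ := not_forall.1 h
    exact plaus_of_ne h' (hne _) (hne _)

theorem plaus_mono {X Y : Set (LStates L)} (hXY : X ⊆ Y) : D.le (plaus X) (plaus Y) := by
  by_cases hX : ∃ ℓ : ↥L, (core ℓ X).Nonempty
  · obtain ⟨ℓ, hℓ⟩ := hX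
    have hY : (core ℓ Y).Nonempty := hℓ.mono (core_mono ℓ hXY)
    by_cases hu : ∀ ℓ', (core ℓ' Y).Nonempty → ℓ' = ℓ
    · rw [plaus_of_unique hY hu,
        plaus_of_unique hℓ fun ℓ' h' => hu ℓ' (h'.mono (core_mono ℓ' hXY))]
      exact ℓ.1.val_mono _ _ (core_mono ℓ hXY) (core_subset_supp ℓ Y)
    · push Not at hu
      obtain ⟨ℓ', h', hne⟩ := hu
      rw [plaus_of_ne hne hY h']
      exact D.le_top _
  · rw [plaus_of_forall_empty (not_exists.1 hX)]
    exact D.bot_le _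

theorem isPlausMeasureD_plaus (hL : L.Nonempty) :
    IsPlausMeasureD D (plaus : Set (LStates L) → P) :=
  ⟨plaus_empty, plaus_univ hL, fun _ _ => plaus_mono⟩

theorem plaus_preimage (ℓ : ↥L) {Y : Set C} (hY : Y ⊆ ℓ.1.supp) :
    plaus {s : LStates L | s.1 ℓ ∈ Y} = ℓ.1.val Y := by
  rcases Y.eq_empty_or_nonempty with rfl | hne
  · rw [ℓ.1.val_empty]
    exact plaus_empty
  by_cases hsupp : ℓ.1.supp ⊆ Y
  · obtain rfl := hY.antisymm hsupp
    have h : {s : LStates L | s.1 ℓ ∈ ℓ.1.supp} = Set.univ := Set.eq_univ_of_forall fun s => s.2 ℓ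
    rw [h, plaus_univ ⟨ℓ.1, ℓ.2⟩, ℓ.1.val_supp]
  · obtain ⟨c₀, hc₀, hc₀Y⟩ := Set.not_subset.1 hsupp
    rw [plaus_of_unique (ℓ := ℓ), core_preimage ℓ hY]
    · rwa [core_preimage ℓ hY]
    · intro ℓ' h'
      by_contra hne'
      rw [core_preimage_of_ne hne' hc₀ hc₀Y] at h'
      exact Set.not_nonempty_empty h'

/-- The act that yields in each state the consequence chosen for `ℓ`. -/
def act (ℓ : ↥L) : SimpleAct (LStates L) C :=
  ⟨fun s => s.1 ℓ, by rw [range_apply]; exact ℓ.1.supp_finite⟩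

end LStates

theorem SimpleLottery.ext_supp_val {ℓ ℓ' : SimpleLottery C D} (hs : ℓ.supp = ℓ'.supp)
    (hv : ℓ.val = ℓ'.val) : ℓ = ℓ' := by
  cases ℓ; cases ℓ'; cases hs; cases hv; rfl

theorem inducedLottery_act (hL : L.Nonempty) (ℓ : ↥L) :
    inducedLottery D LStates.plaus (LStates.isPlausMeasureD_plaus hL) inferInstance
      (LStates.act ℓ) = ℓ.1 := by
  refine SimpleLottery.ext_supp_val (LStates.range_apply ℓ) (funext fun Y => ?_)
  change LStates.plaus {s : LStates L | s.1 ℓ ∈ Y ∩ Set.range fun s : LStates L => s.1 ℓ} = _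
  rw [LStates.range_apply, LStates.plaus_preimage ℓ Set.inter_subset_right, ← ℓ.1.val_inter]

end LotteryConstruction

/-- Every preference relation in the lottery framework can be modeled by a preference
relation in the act framework: for every lottery decision situation `(L, C, P)` and every
binary relation `⪯_L` on lotteries, there are a plausibilistic decision situation
`((A,S,C), P, Pl)` inducing `(L, C, P)` and a binary relation `⪯_A` on its acts such that
`a₁ ⪯_A a₂` iff `ℓ^Pl_{a₁} ⪯_L ℓ^Pl_{a₂}`. -/
theorem lottery_preferences_modeled_by_acts {C : Type v} {P : Type x}
    (D : PlausDomain P) (L : Set (SimpleLottery C D)) (hL : L.Nonempty)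
    (rL : SimpleLottery C D → SimpleLottery C D → Prop) :
    ∃ (S : Type (max v x)) (hS : Nonempty S) (A : Set (SimpleAct S C))
      (Pl : Set S → P) (hPl : IsPlausMeasureD D Pl)
      (rA : SimpleAct S C → SimpleAct S C → Prop),
      {m | ∃ a ∈ A, m = inducedLottery D Pl hPl hS a} = L ∧
      ∀ a₁ ∈ A, ∀ a₂ ∈ A,
        (rA a₁ a₂ ↔
          rL (inducedLottery D Pl hPl hS a₁) (inducedLottery D Pl hPl hS a₂)) := by
  refine ⟨LStates L, inferInstance, Set.range LStates.act, LStates.plaus,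
    LStates.isPlausMeasureD_plaus hL, fun a₁ a₂ => rL
      (inducedLottery D LStates.plaus (LStates.isPlausMeasureD_plaus hL) inferInstance a₁)
      (inducedLottery D LStates.plaus (LStates.isPlausMeasureD_plaus hL) inferInstance a₂),
    ?_, fun _ _ _ _ => Iff.rfl⟩
  ext m
  constructor
  · rintro ⟨_, ⟨ℓ, rfl⟩, rfl⟩
    rw [inducedLottery_act hL ℓ]
    exact ℓ.2
  · exact fun hm => ⟨_, ⟨⟨m, hm⟩, rfl⟩, (inducedLottery_act hL ⟨m, hm⟩).symm⟩
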